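/- In any execution of the AGS coding scheme Π (Algorithms 3–4) on inputs (x,y) with an arbitrary erasure pattern, for every round i with 1 ≤ i ≤ t_A: if r_B(i) = r_A(i)+1 and r_A(i+1) = r_A(i)+1, then the information bit that Bob sends in round i satisfies b_B(i) = π(y | T^A(i)∘π(x|T^A(i))). -/

import Mathlib

/-!
Model of the AGS coding scheme Π (Algorithms 3–4) of "Interactive coding resilient to
an unknown number of erasures".  A noiseless alternating binary protocol `π` of length
`N` is given by next-bit functions `fA fB : List Bool → Bool` (`fA t = π(x∣t)` on
even-length transcripts, `fB t = π(y∣t)` on odd-length transcripts).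
Rounds are 1-indexed; round `i` consists of two timesteps whose erasures are given by
`(E i).1` (odd timestep, Alice → Bob) and `(E i).2` (even timestep, Bob → Alice).
In each timestep the sender either transmits a symbol `(b, ρ) ∈ {0,1}×{0,1}` or stays
silent (`□`); a reception is `none` (= the erasure mark ⊥) or `some` of a symbol.
-/

namespace AGS

/-- A transmitted symbol: a message `(bit, parity)`, or silence `□`. -/
inductive Sym where
  | msg : Bool → Bool → Sym
  | sil : Sym
deriving DecidableEq

/-- The word (information-bit content) of a symbol: one bit for a message, the empty
word for silence. -/
def symWord : Sym → List Bool
  | Sym.msg b _ => [b]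
  | Sym.sil => []

/-- Parity of a round number, as a Boolean. -/
def par (r : ℕ) : Bool := decide (r % 2 = 1)

/-- Joint state at the beginning of a round: Alice's transcript `TA`, counter `rA`,
flag `abot` (her last reception was ⊥); Bob's transcript `TB`, counter `rB`, and
stored bit `bsend`. -/
structure St where
  TA : List Bool
  rA : ℕ
  abot : Bool
  TB : List Bool
  rB : ℕ
  bsend : Bool
deriving DecidableEq

/-- The initial state. -/
def init : St := ⟨[], 0, false, [], 0, false⟩

/-- The symbol Alice sends in the odd timestep of a round (silence if her last
reception was erased, and implicit silence after she has terminated). -/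
def sentA (fA : List Bool → Bool) (N : ℕ) (s : St) : Sym :=
  if s.rA < N / 2 then
    if s.abot then Sym.sil else Sym.msg (fA s.TA) (par (s.rA + 1))
  else Sym.sil

/-- Bob's reception in the odd timestep (`none` = erasure mark ⊥). -/
def recvB (fA : List Bool → Bool) (N : ℕ) (e1 : Bool) (s : St) : Option Sym :=
  if e1 then none else some (sentA fA N s)

/-- Bob's update of `TB, rB, bsend` in the odd timestep, given his reception. -/
def bobUpd (fB : List Bool → Bool) (N : ℕ) (r : Option Sym) (s : St) : St :=
  if s.rB < N / 2 then
    match r with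
    | some (Sym.msg b p) =>
        if p = par (s.rB + 1) then
          { s with rB := s.rB + 1, bsend := fB (s.TB ++ [b]),
                   TB := (s.TB ++ [b]) ++ [fB (s.TB ++ [b])] }
        else s
    | _ => s
  else s

/-- The symbol Bob sends in the even timestep of a round, given the erasure `e1` of
the odd timestep and the state `s` at the beginning of the round.  In the normal
phase (`rB < N/2`) he answers any non-⊥ reception with his (possibly just updated)
stored message and is silent upon ⊥; in the termination phase (`rB = N/2`) he answers
only a non-silent message of matching parity, and is silent otherwise. -/
def sentB (fA fB : List Bool → Bool) (N : ℕ) (e1 : Bool) (s : St) : Sym :=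
  let r := recvB fA N e1 s
  if s.rB < N / 2 then
    match r with
    | none => Sym.sil
    | some _ =>
        let s' := bobUpd fB N r s
        Sym.msg s'.bsend (par s'.rB)
  else
    match r with
    | some (Sym.msg _ p) => if p = par s.rB then Sym.msg s.bsend (par s.rB) else Sym.sil
    | _ => Sym.sil

/-- One round of the AGS coding scheme.  After Alice terminates (`rA = N/2`) her part
of the state is frozen and only Bob's part evolves (he keeps receiving silence, unless
erased). -/
def step (fA fB : List Bool → Bool) (N : ℕ) (e : Bool × Bool) (s : St) : St :=
  let r := recvB fA N e.1 s
  let sB := bobUpd fB N r s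
  if s.rA < N / 2 then
    let mB := sentB fA fB N e.1 s
    let rcvA : Option Sym := if e.2 then none else some mB
    match rcvA with
    | none => { sB with rA := s.rA, abot := true }
    | some (Sym.msg b p) =>
        if p = par (s.rA + 1) then
          { sB with TA := (s.TA ++ [fA s.TA]) ++ [b], rA := s.rA + 1, abot := false }
        else { sB with rA := s.rA, abot := false }
    | some Sym.sil => { sB with rA := s.rA, abot := false }
  else sB

/-- `exec fA fB N E k` is the state after `k` rounds have been played. -/
def exec (fA fB : List Bool → Bool) (N : ℕ) (E : ℕ → Bool × Bool) : ℕ → St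
  | 0 => init
  | k + 1 => step fA fB N (E (k + 1)) (exec fA fB N E k)

/-- `stAt fA fB N E i` is the state at the beginning of round `i` (rounds 1-indexed):
for a protocol variable `v`, `v(i) = (stAt … i).v`. -/
def stAt (fA fB : List Bool → Bool) (N : ℕ) (E : ℕ → Bool × Bool) (i : ℕ) : St :=
  exec fA fB N E (i - 1)

/-- The noiseless transcript of `π` after `r` rounds; `transcript fA fB (N/2)` is `T^π`. -/
def transcript (fA fB : List Bool → Bool) : ℕ → List Bool
  | 0 => []
  | r + 1 =>
    let t := transcript fA fB r
    (t ++ [fA t]) ++ [fB (t ++ [fA t])]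

/-- `cA … i` : the number of rounds `j < i` in which Alice sent a non-silent message. -/
def cA (fA fB : List Bool → Bool) (N : ℕ) (E : ℕ → Bool × Bool) (i : ℕ) : ℕ :=
  ((Finset.Ico 1 i).filter fun j => sentA fA N (stAt fA fB N E j) ≠ Sym.sil).card

/-- `cB … i` : the number of rounds `j < i` in which Bob sent a non-silent message. -/
def cB (fA fB : List Bool → Bool) (N : ℕ) (E : ℕ → Bool × Bool) (i : ℕ) : ℕ :=
  ((Finset.Ico 1 i).filter fun j =>
    sentB fA fB N (E j).1 (stAt fA fB N E j) ≠ Sym.sil).card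

/-- `cch … i` : the total number of ⊥ receptions of Bob and of Alice in the rounds
before round `i` (Alice receives only while she is active). -/
def cch (fA fB : List Bool → Bool) (N : ℕ) (E : ℕ → Bool × Bool) (i : ℕ) : ℕ :=
  ((Finset.Ico 1 i).filter fun j => (E j).1 = true).card +
  ((Finset.Ico 1 i).filter fun j =>
    (E j).2 = true ∧ (stAt fA fB N E j).rA < N / 2).card

/-- The two joint states reachable in an execution: either the parties are in sync, or Bob is
exactly one protocol round ahead of Alice and his stored bit is the reply she awaits. -/
def Coupled (fA fB : List Bool → Bool) (s : St) : Prop :=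
  (s.rB = s.rA ∧ s.TB = s.TA) ∨
  (s.rB = s.rA + 1 ∧ s.bsend = fB (s.TA ++ [fA s.TA]) ∧
    s.TB = (s.TA ++ [fA s.TA]) ++ [fB (s.TA ++ [fA s.TA])])

theorem par_succ (r : ℕ) : par (r + 1) = !par r := by
  rcases Nat.mod_two_eq_zero_or_one r with h | h <;> simp [par, Nat.add_mod, h]

theorem Coupled.step {fA fB : List Bool → Bool} {N : ℕ} {s : St} (h : Coupled fA fB s)
    (e : Bool × Bool) : Coupled fA fB (AGS.step fA fB N e s) := by
  obtain ⟨TA, rA, abot, TB, rB, bsend⟩ := s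
  obtain ⟨e1, e2⟩ := e
  rcases h with ⟨h1, h2⟩ | ⟨h1, h2, h3⟩
  · simp only at h1 h2
    subst h1 h2
    by_cases hlt : rB < N / 2 <;> cases e1 <;> cases e2 <;> cases abot <;>
      simp [Coupled, AGS.step, bobUpd, sentB, recvB, sentA, hlt, par_succ]
  · simp only at h1 h2 h3
    subst h1 h2 h3
    by_cases hlt : rA < N / 2 <;> by_cases hlt' : rA + 1 < N / 2 <;>
      cases e1 <;> cases e2 <;> cases abot <;>
      simp [Coupled, AGS.step, bobUpd, sentB, recvB, sentA, hlt, hlt', par_succ]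

theorem coupled_exec (fA fB : List Bool → Bool) (N : ℕ) (E : ℕ → Bool × Bool) (k : ℕ) :
    Coupled fA fB (exec fA fB N E k) := by
  induction k with
  | zero => exact Or.inl ⟨rfl, rfl⟩
  | succ k ih => exact ih.step _

/-- If Bob is ahead and Alice advances, then Bob has sent his stored bit. -/
theorem symWord_sentB_of_advance {fA fB : List Bool → Bool} {N : ℕ} {s : St} {e : Bool × Bool}
    (hlt : s.rA < N / 2) (hshift : s.rB = s.rA + 1)
    (hinc : (step fA fB N e s).rA = s.rA + 1) :
    symWord (sentB fA fB N e.1 s) = [s.bsend] := by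
  obtain ⟨TA, rA, abot, TB, rB, bsend⟩ := s
  obtain ⟨e1, e2⟩ := e
  simp only at hlt hshift
  subst hshift
  revert hinc
  by_cases hlt' : rA + 1 < N / 2 <;> cases e1 <;> cases e2 <;> cases abot <;>
    simp [step, bobUpd, sentB, recvB, sentA, hlt, hlt', par_succ, symWord]

/-- Claim inside Lemma 13 of the paper.  In any execution of the
AGS scheme, for every round `1 ≤ i ≤ t_A`: if `r_B(i) = r_A(i) + 1` and
`r_A(i+1) = r_A(i) + 1`, then the information bit Bob sends in round `i` is
`π(y ∣ T^A(i)∘π(x∣T^A(i)))`. -/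
theorem ags_bob_bit_correct
    (fA fB : List Bool → Bool) (N : ℕ) (hN : 0 < N) (hNeven : Even N)
    (E : ℕ → Bool × Bool) (tA : ℕ)
    (htA1 : ∀ i, 1 ≤ i → i ≤ tA → (stAt fA fB N E i).rA < N / 2)
    (htA2 : (stAt fA fB N E (tA + 1)).rA = N / 2)
    (i : ℕ) (hi1 : 1 ≤ i) (hi2 : i ≤ tA)
    (hshift : (stAt fA fB N E i).rB = (stAt fA fB N E i).rA + 1)
    (hinc : (stAt fA fB N E (i + 1)).rA = (stAt fA fB N E i).rA + 1) :
    symWord (sentB fA fB N (E i).1 (stAt fA fB N E i)) =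
      [fB ((stAt fA fB N E i).TA ++ [fA (stAt fA fB N E i).TA])] := by
  obtain ⟨k, rfl⟩ := Nat.exists_eq_add_of_le' hi1
  rw [symWord_sentB_of_advance (htA1 _ hi1 hi2) hshift hinc]
  rcases coupled_exec fA fB N E k with ⟨h, -⟩ | ⟨-, h, -⟩
  · exact absurd (h.symm.trans hshift) (Nat.succ_ne_self _).symm
  · exact congrArg (fun b => [b]) h

end AGS
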